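/- arXiv:1411.0474 — 10 statements merged into one kernel-verified Lean document; each statement's English description precedes it below -/
import Mathlib

section
/- Let S = (V, f) be a bi-coloured system, and let {a_1, b_1}, ..., {a_t, b_t} be t distinct 2-element subsets of V that all generate the same red line, i.e., R(a_i b_i) is the same set L for all i = 1, ..., t. Let X = ∪_{i=1}^{t} {a_i, b_i}. Then the blue lines B(a_1 b_1), ..., B(a_t b_t) are t pairwise distinct sets, and moreover B(a_i b_i) ∩ X = {a_i, b_i} for every i. -/
/-- The red line generated by two distinct points `u` and `v` in a bi-coloured
system `(V, f)`, where `f : Finset V → Bool` colours each 3-element subset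
(`true` = red, `false` = blue). -/
def redLine {V : Type*} [DecidableEq V] (f : Finset V → Bool) (u v : V) : Set V :=
  {u, v} ∪ {p | p ≠ u ∧ p ≠ v ∧ f {u, v, p} = true}

/-- The blue line generated by two distinct points `u` and `v`. -/
def blueLine {V : Type*} [DecidableEq V] (f : Finset V → Bool) (u v : V) : Set V :=
  {u, v} ∪ {p | p ≠ u ∧ p ≠ v ∧ f {u, v, p} = false}

/-- The set of distinct red lines of the system. -/
def redLines {V : Type*} [DecidableEq V] (f : Finset V → Bool) : Set (Set V) :=
  {L | ∃ u v : V, u ≠ v ∧ L = redLine f u v}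

/-- The set of distinct blue lines of the system. -/
def blueLines {V : Type*} [DecidableEq V] (f : Finset V → Bool) : Set (Set V) :=
  {L | ∃ u v : V, u ≠ v ∧ L = blueLine f u v}

/-- `m_S(R)`, the number of distinct red lines. -/
noncomputable def numRed {V : Type*} [DecidableEq V] (f : Finset V → Bool) : ℕ :=
  (redLines f).ncard

/-- `m_S(B)`, the number of distinct blue lines. -/
noncomputable def numBlue {V : Type*} [DecidableEq V] (f : Finset V → Bool) : ℕ :=
  (blueLines f).ncard

theorem pair_subset_redLine {V : Type*} [DecidableEq V] (f : Finset V → Bool) (u v : V) :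
    {u, v} ⊆ redLine f u v :=
  Set.subset_union_left

theorem pair_subset_blueLine {V : Type*} [DecidableEq V] (f : Finset V → Bool) (u v : V) :
    {u, v} ⊆ blueLine f u v :=
  Set.subset_union_left

theorem blueLine_inter_redLine {V : Type*} [DecidableEq V] (f : Finset V → Bool) (u v : V) :
    blueLine f u v ∩ redLine f u v = {u, v} := by
  refine Set.Subset.antisymm ?_
    (Set.subset_inter (pair_subset_blueLine f u v) (pair_subset_redLine f u v))
  rintro p ⟨hp | ⟨-, -, hblue⟩, hq | ⟨-, -, hred⟩⟩
  · exact hp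
  · exact hp
  · exact hq
  · simp [hblue] at hred

/-- If `{a i, b i}` (`i = 1, …, t`) are `t` distinct pairs that all generate the
same red line, then the blue lines `B(a i, b i)` are `t` pairwise distinct sets,
and `B(a i, b i) ∩ X = {a i, b i}` where `X = ⋃ i, {a i, b i}`. -/
theorem stmt_0 {V : Type*} [Fintype V] [DecidableEq V] (f : Finset V → Bool)
    {t : ℕ} (a b : Fin t → V)
    (hab : ∀ i, a i ≠ b i)
    (hdist : ∀ i j, i ≠ j → ({a i, b i} : Finset V) ≠ {a j, b j})
    (L : Set V) (hL : ∀ i, redLine f (a i) (b i) = L) :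
    (∀ i j, i ≠ j → blueLine f (a i) (b i) ≠ blueLine f (a j) (b j)) ∧
    (∀ i, blueLine f (a i) (b i) ∩ (⋃ j, ({a j, b j} : Set V)) = {a i, b i}) := by
  have hinter : ∀ i, blueLine f (a i) (b i) ∩ (⋃ j, ({a j, b j} : Set V)) = {a i, b i} := by
    intro i
    refine Set.Subset.antisymm ?_ (Set.subset_inter (pair_subset_blueLine f _ _)
      (Set.subset_iUnion (fun j => ({a j, b j} : Set V)) i))
    have hX : (⋃ j, ({a j, b j} : Set V)) ⊆ redLine f (a i) (b i) :=
      Set.iUnion_subset fun j =>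
        (pair_subset_redLine f (a j) (b j)).trans ((hL j).trans (hL i).symm).subset
    exact (Set.inter_subset_inter_right _ hX).trans (blueLine_inter_redLine f _ _).subset
  refine ⟨fun i j hij h => hdist i j hij ?_, hinter⟩
  apply Finset.coe_injective
  simp only [Finset.coe_pair]
  rw [← hinter i, ← hinter j, h]
end

section
/- For every bi-coloured system S on a set of n ≥ 2 points, m_S ≥ 2·√(n(n−1)/2); equivalently, (m_S(R) + m_S(B))² ≥ 4·C(n,2). -/
theorem redLine_inter_blueLine {V : Type*} [DecidableEq V] (f : Finset V → Bool) (u v : V) :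
    redLine f u v ∩ blueLine f u v = {u, v} := by
  ext p
  simp only [redLine, blueLine, Set.mem_inter_iff, Set.mem_union, Set.mem_insert_iff,
    Set.mem_singleton_iff, Set.mem_ofPred_eq]
  grind

theorem choose_two_le_numRed_mul_numBlue {V : Type*} [Fintype V] [DecidableEq V]
    (f : Finset V → Bool) :
    (Fintype.card V).choose 2 ≤ numRed f * numBlue f := by
  have hsub : (fun s : Finset V => (s : Set V)) ''
        ↑(Finset.univ.powersetCard 2 : Finset (Finset V)) ⊆
      (fun L : Set V × Set V => L.1 ∩ L.2) '' (redLines f ×ˢ blueLines f) := by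
    rintro _ ⟨s, hs, rfl⟩
    obtain ⟨u, v, huv, rfl⟩ := Finset.card_eq_two.mp (Finset.mem_powersetCard.mp hs).2
    exact ⟨(redLine f u v, blueLine f u v), ⟨⟨u, v, huv, rfl⟩, ⟨u, v, huv, rfl⟩⟩,
      by simpa using redLine_inter_blueLine f u v⟩
  calc (Fintype.card V).choose 2
      = ((fun s : Finset V => (s : Set V)) ''
          ↑(Finset.univ.powersetCard 2 : Finset (Finset V))).ncard := by
        rw [Set.ncard_image_of_injective _ Finset.coe_injective, Set.ncard_coe_finset,
          Finset.card_powersetCard, Finset.card_univ]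
    _ ≤ ((fun L : Set V × Set V => L.1 ∩ L.2) '' (redLines f ×ˢ blueLines f)).ncard :=
        Set.ncard_le_ncard hsub (Set.toFinite _)
    _ ≤ (redLines f ×ˢ blueLines f).ncard := Set.ncard_image_le (Set.toFinite _)
    _ = numRed f * numBlue f := Set.ncard_prod

/-- For every bi-coloured system on `n ≥ 2` points,
`(m_S(R) + m_S(B))² ≥ 4 · C(n,2)`, i.e. `m_S ≥ 2·√(n(n−1)/2)`. -/
theorem stmt_1 {V : Type*} [Fintype V] [DecidableEq V] (f : Finset V → Bool)
    (hn : 2 ≤ Fintype.card V) :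
    4 * Nat.choose (Fintype.card V) 2 ≤ (numRed f + numBlue f) ^ 2 := by
  calc 4 * (Fintype.card V).choose 2
      ≤ 4 * (numRed f * numBlue f) := Nat.mul_le_mul_left 4 (choose_two_le_numRed_mul_numBlue f)
    _ = 4 * numRed f * numBlue f := (mul_assoc _ _ _).symm
    _ ≤ (numRed f + numBlue f) ^ 2 := four_mul_le_sq_add _ _
end

section
/- For every bi-coloured system S on a set of n ≥ 2 points, m*_S = m_S(R) · m_S(B) ≥ n(n−1)/2. -/
/-- For every bi-coloured system on `n ≥ 2` points,
`m*_S = m_S(R) · m_S(B) ≥ n(n−1)/2`. -/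
theorem stmt_2 {V : Type*} [Fintype V] [DecidableEq V] (f : Finset V → Bool)
    (hn : 2 ≤ Fintype.card V) :
    Fintype.card V * (Fintype.card V - 1) / 2 ≤ numRed f * numBlue f := by
  have hsub : (fun s : Finset V ↦ (s : Set V)) '' (Finset.univ.powersetCard 2 : Finset (Finset V)) ⊆
      (fun q : Set V × Set V ↦ q.1 ∩ q.2) '' (redLines f ×ˢ blueLines f) := by
    rintro _ ⟨s, hs, rfl⟩
    obtain ⟨u, v, huv, rfl⟩ := Finset.card_eq_two.mp (Finset.mem_powersetCard.mp hs).2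
    exact ⟨(redLine f u v, blueLine f u v), ⟨⟨u, v, huv, rfl⟩, ⟨u, v, huv, rfl⟩⟩,
      by simpa using redLine_inter_blueLine f u v⟩
  calc Fintype.card V * (Fintype.card V - 1) / 2
      = ((fun s : Finset V ↦ (s : Set V)) ''
          (Finset.univ.powersetCard 2 : Finset (Finset V))).ncard := by
        rw [Set.ncard_image_of_injective _ Finset.coe_injective, Set.ncard_coe_finset,
          Finset.card_powersetCard, Finset.card_univ, Nat.choose_two_right]
    _ ≤ ((fun q : Set V × Set V ↦ q.1 ∩ q.2) '' (redLines f ×ˢ blueLines f)).ncard :=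
        Set.ncard_le_ncard hsub (Set.toFinite _)
    _ ≤ (redLines f ×ˢ blueLines f).ncard := Set.ncard_image_le (Set.toFinite _)
    _ = numRed f * numBlue f := Set.ncard_prod
end

section
/- Let S = (V, f) be a bi-coloured system on n ≥ 3 points. Then m*_S = m_S(R) · m_S(B) = n(n−1)/2 if and only if all 3-element subsets of V receive the same colour under f (i.e., the hypergraph of red triples is the complete 3-uniform hypergraph or the empty hypergraph). -/
theorem redLine_union_blueLine {V : Type*} [DecidableEq V] (f : Finset V → Bool) (u v : V) :
    redLine f u v ∪ blueLine f u v = Set.univ := by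
  ext p
  simp only [redLine, blueLine, Set.mem_union, Set.mem_insert_iff,
    Set.mem_singleton_iff, Set.mem_ofPred_eq, Set.mem_univ, iff_true]
  cases f {u, v, p} <;> simp <;> tauto

theorem redLines_not {V : Type*} [DecidableEq V] (f : Finset V → Bool) :
    redLines (fun s => !f s) = blueLines f := by
  simp [redLines, blueLines, redLine, blueLine]

theorem blueLines_not {V : Type*} [DecidableEq V] (f : Finset V → Bool) :
    blueLines (fun s => !f s) = redLines f := by
  simp [redLines, blueLines, redLine, blueLine]

theorem ncard_setOf_pair {V : Type*} [Fintype V] :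
    {s : Set V | ∃ u v, u ≠ v ∧ s = {u, v}}.ncard =
      Fintype.card V * (Fintype.card V - 1) / 2 := by
  classical
  have h : {s : Set V | ∃ u v, u ≠ v ∧ s = {u, v}} =
      (fun t : Finset V => (t : Set V)) '' (Finset.univ.powersetCard 2 : Finset (Finset V)) := by
    ext s
    simp only [Set.mem_ofPred_eq, Set.mem_image, Finset.mem_coe, Finset.mem_powersetCard_univ,
      Finset.card_eq_two]
    constructor
    · rintro ⟨u, v, huv, rfl⟩
      exact ⟨{u, v}, ⟨u, v, huv, rfl⟩, by simp⟩
    · rintro ⟨_, ⟨u, v, huv, rfl⟩, rfl⟩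
      exact ⟨u, v, huv, by simp⟩
  rw [h, Set.ncard_image_of_injective _ Finset.coe_injective, Set.ncard_coe_finset,
    Finset.card_powersetCard, Finset.card_univ, Nat.choose_two_right]

theorem numRed_mul_numBlue_of_forall_true {V : Type*} [Fintype V] [DecidableEq V]
    {f : Finset V → Bool} (hn : 3 ≤ Fintype.card V)
    (hf : ∀ s : Finset V, s.card = 3 → f s = true) :
    numRed f * numBlue f = Fintype.card V * (Fintype.card V - 1) / 2 := by
  have hblue : ∀ u v : V, u ≠ v → blueLine f u v = {u, v} := by
    intro u v huv
    refine Set.union_eq_left.2 ?_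
    rintro p ⟨hpu, hpv, hp⟩
    rw [hf _ (Finset.card_eq_three.2 ⟨u, v, p, huv, hpu.symm, hpv.symm, rfl⟩)] at hp
    cases hp
  have hred : ∀ u v : V, u ≠ v → redLine f u v = Set.univ := by
    intro u v huv
    have h := redLine_union_blueLine f u v
    rwa [hblue u v huv, Set.union_eq_left.2 (show {u, v} ⊆ redLine f u v from
      Set.subset_union_left)] at h
  have hreds : redLines f = {Set.univ} := by
    obtain ⟨u, v, huv⟩ := Fintype.exists_pair_of_one_lt_card (show 1 < Fintype.card V by omega)
    ext L
    constructor
    · rintro ⟨u, v, huv, rfl⟩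
      exact hred u v huv
    · rintro rfl
      exact ⟨u, v, huv, (hred u v huv).symm⟩
  have hblues : blueLines f = {s : Set V | ∃ u v, u ≠ v ∧ s = {u, v}} := by
    ext L
    refine exists₂_congr fun u v => and_congr_right fun huv => ?_
    rw [hblue u v huv]
  rw [numRed, numBlue, hreds, hblues, Set.ncard_singleton, one_mul, ncard_setOf_pair]

/-- If the product of the numbers of lines is minimal, every red line and every blue line have a
common generating pair, hence together cover `V`. -/
theorem union_eq_univ_of_numRed_mul_numBlue {V : Type*} [Fintype V] [DecidableEq V]
    {f : Finset V → Bool}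
    (h : numRed f * numBlue f = Fintype.card V * (Fintype.card V - 1) / 2)
    {L M : Set V} (hL : L ∈ redLines f) (hM : M ∈ blueLines f) : L ∪ M = Set.univ := by
  set T : Set (Set V × Set V) := {x | ∃ u v, u ≠ v ∧ x = (redLine f u v, blueLine f u v)}
  have hsub : T ⊆ redLines f ×ˢ blueLines f := by
    rintro _ ⟨u, v, huv, rfl⟩
    exact ⟨⟨u, v, huv, rfl⟩, ⟨u, v, huv, rfl⟩⟩
  have himage : {s : Set V | ∃ u v, u ≠ v ∧ s = {u, v}} ⊆ (fun x => x.1 ∩ x.2) '' T := by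
    rintro _ ⟨u, v, huv, rfl⟩
    exact ⟨_, ⟨u, v, huv, rfl⟩, redLine_inter_blueLine f u v⟩
  have hcard : (redLines f ×ˢ blueLines f).ncard ≤ T.ncard := by
    rw [Set.ncard_prod]
    change numRed f * numBlue f ≤ _
    rw [h, ← ncard_setOf_pair]
    exact (Set.ncard_le_ncard himage (Set.toFinite _)).trans
      (Set.ncard_image_le (Set.toFinite _))
  have hmem : (L, M) ∈ T := by
    rw [Set.eq_of_subset_of_ncard_le hsub hcard (Set.toFinite _)]
    exact ⟨hL, hM⟩
  obtain ⟨u, v, -, huv⟩ := hmem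
  obtain ⟨rfl, rfl⟩ := Prod.mk.inj huv
  exact redLine_union_blueLine f u v

/-- For a bi-coloured system on `n ≥ 3` points, `m_S(R) · m_S(B) = n(n−1)/2`
iff all 3-element subsets receive the same colour. -/
theorem stmt_3 {V : Type*} [Fintype V] [DecidableEq V] (f : Finset V → Bool)
    (hn : 3 ≤ Fintype.card V) :
    numRed f * numBlue f = Fintype.card V * (Fintype.card V - 1) / 2 ↔
      ((∀ s : Finset V, s.card = 3 → f s = true) ∨
       (∀ s : Finset V, s.card = 3 → f s = false)) := by
  constructor
  · intro h
    by_contra! hne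
    obtain ⟨⟨s, hs, hfs⟩, t, ht, hft⟩ := hne
    obtain ⟨x, y, q, hxy, hxq, hyq, rfl⟩ := Finset.card_eq_three.1 hs
    obtain ⟨a, b, p, hab, hap, hbp, rfl⟩ := Finset.card_eq_three.1 ht
    have hq : ∀ u v, u ≠ v → q ∈ blueLine f u v := by
      intro u v huv
      have hmem : q ∈ redLine f x y ∪ blueLine f u v := by
        rw [union_eq_univ_of_numRed_mul_numBlue h ⟨x, y, hxy, rfl⟩ ⟨u, v, huv, rfl⟩]
        trivial
      refine hmem.resolve_left ?_
      simp [redLine, hxq.symm, hyq.symm, hfs]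
    have hp : ∀ u v, u ≠ v → p ∈ redLine f u v := by
      intro u v huv
      have hmem : p ∈ redLine f u v ∪ blueLine f a b := by
        rw [union_eq_univ_of_numRed_mul_numBlue h ⟨u, v, huv, rfl⟩ ⟨a, b, hab, rfl⟩]
        trivial
      refine hmem.resolve_right ?_
      simp [blueLine, hap.symm, hbp.symm, hft]
    have hpq : p ≠ q := by
      rintro rfl
      have hpab := hq a b hab
      simp [blueLine, hap.symm, hbp.symm, hft] at hpab
    obtain ⟨c, hc⟩ := Finset.exists_mem_notMem_of_card_lt_card
      (s := {p, q}) (t := Finset.univ)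
      (Finset.card_le_two.trans_lt (by rw [Finset.card_univ]; omega))
    simp only [Finset.mem_univ, Finset.mem_insert, Finset.mem_singleton, not_or, true_and] at hc
    obtain ⟨hcp, hcq⟩ := hc
    have hblue : f {c, p, q} = false := by
      simpa [blueLine, Ne.symm hcq, hpq.symm] using hq c p hcp
    have hred : f {c, q, p} = true := by
      simpa [redLine, Ne.symm hcp, hpq] using hp c q hcq
    rw [Finset.pair_comm q p, hblue] at hred
    cases hred
  · rintro (hf | hf)
    · exact numRed_mul_numBlue_of_forall_true hn hf
    · rw [← numRed_mul_numBlue_of_forall_true (f := fun s => !f s) hn (by simpa using hf),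
        mul_comm, numRed, numBlue, numRed, numBlue, redLines_not, blueLines_not]
end

section
/- For every integer n ≥ 2 there exists a bi-coloured system S on n points with m_S ≤ n · ⌈log₂ n⌉; i.e., m(n) ≤ n⌈log₂ n⌉. -/
/-- `i` is the largest index at which the bit sequences of `x` and `y` differ. -/
def IsTopDiff {V : Type*} (b : V → ℕ → Bool) (x y : V) (i : ℕ) : Prop :=
  b x i ≠ b y i ∧ ∀ j, i < j → b x j = b y j

namespace IsTopDiff

variable {V : Type*} {b : V → ℕ → Bool} {x y : V} {i j : ℕ}

theorem symm (h : IsTopDiff b x y i) : IsTopDiff b y x i :=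
  ⟨h.1.symm, fun j hj => (h.2 j hj).symm⟩

theorem unique (h : IsTopDiff b x y i) (h' : IsTopDiff b x y j) : i = j := by
  rcases lt_trichotomy i j with hij | hij | hij
  · exact absurd (h.2 j hij) h'.1
  · exact hij
  · exact absurd (h'.2 i hij) h.1

end IsTopDiff

/-- The colouring induced by a binary tree: a triple is red when, at the node where it first
splits, two of its points go to the `false` side. -/
noncomputable def treeColouring {V : Type*} (b : V → ℕ → Bool) (s : Finset V) : Bool :=
  open Classical in
  decide (∃ l, (∀ x ∈ s, ∀ y ∈ s, ∀ m, l < m → b x m = b y m) ∧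
    ∃ x ∈ s, ∃ y ∈ s, x ≠ y ∧ b x l = false ∧ b y l = false ∧ ∃ z ∈ s, b z l = true)

/-- The common value of all lines spanned by `x` and a point splitting from `x` at level `i`, in
the colour determined by the bit of `x` at level `i`. -/
def treeLine {V : Type*} (b : V → ℕ → Bool) (x : V) (i : ℕ) : Set V :=
  {p | p = x ∨ IsTopDiff b x p i ∨ ∃ j, i < j ∧ IsTopDiff b x p j ∧ b x j = !b x i}

section Tree

variable {V : Type*} [DecidableEq V] {b : V → ℕ → Bool}

theorem treeColouring_triple {x y z : V} {l : ℕ} (hxy : x ≠ y)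
    (h : ∀ m, l ≤ m → b x m = b y m) (hz : IsTopDiff b x z l) :
    treeColouring b {x, y, z} = !b x l := by
  obtain ⟨hl, hm⟩ := hz
  have hy := h l le_rfl
  have key : ∀ m, l < m → b y m = b x m ∧ b z m = b x m :=
    fun m hlm => ⟨(h m hlm.le).symm, (hm m hlm).symm⟩
  cases hx : b x l
  · have hzl : b z l = true := by grind
    simp only [treeColouring, Bool.not_false, decide_eq_true_eq]
    refine ⟨l, ?_, x, by simp, y, by simp, hxy, hx, by rw [← hy, hx], z, by simp, hzl⟩
    intro p hp q hq m hlm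
    have := key m hlm
    simp only [Finset.mem_insert, Finset.mem_singleton] at hp hq
    rcases hp with rfl | rfl | rfl <;> rcases hq with rfl | rfl | rfl <;> simp_all
  · simp only [treeColouring, Bool.not_true, decide_eq_false_iff_not]
    rintro ⟨l', hagree, p, hp, q, hq, hpq, hp0, hq0, r, hr, hr1⟩
    rcases lt_trichotomy l' l with hlt | rfl | hlt
    · exact hl (hagree x (by simp) z (by simp) l hlt)
    · simp only [Finset.mem_insert, Finset.mem_singleton] at hp hq
      grind
    · have := key l' hlt
      simp only [Finset.mem_insert, Finset.mem_singleton] at hp hr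
      grind

omit [DecidableEq V] in
theorem mem_treeLine_iff {x p : V} {i j : ℕ} (hp : p ≠ x) (h : IsTopDiff b x p j) :
    p ∈ treeLine b x i ↔ i = j ∨ i < j ∧ b x j = !b x i := by
  constructor
  · rintro (h' | h' | ⟨j', hj', h', hb⟩)
    · exact absurd h' hp
    · exact Or.inl (h'.unique h)
    · rw [h.unique h']
      exact Or.inr ⟨hj', hb⟩
  · rintro (rfl | ⟨hj, hb⟩)
    · exact Or.inr (Or.inl h)
    · exact Or.inr (Or.inr ⟨j, hj, h, hb⟩)

theorem treeColouring_eq_iff (hb : ∀ x y : V, x ≠ y → ∃ i, IsTopDiff b x y i)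
    {x y p : V} {i : ℕ} (hxy : IsTopDiff b x y i) (hpx : p ≠ x) (hpy : p ≠ y) :
    treeColouring b {x, y, p} = b x i ↔ p ∈ treeLine b x i := by
  obtain ⟨j, hj⟩ := hb x p hpx.symm
  have hne : x ≠ y := by rintro rfl; exact hxy.1 rfl
  rw [mem_treeLine_iff hpx hj]
  rcases lt_trichotomy i j with hij | rfl | hij
  · rw [treeColouring_triple hne (fun m hm => hxy.2 m (hij.trans_le hm)) hj]
    cases b x i <;> cases b x j <;> grind
  · have hyp : ∀ m, i ≤ m → b y m = b p m := by
      intro m hm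
      rcases hm.eq_or_lt with rfl | hm
      · rw [Bool.eq_not_of_ne hxy.1.symm, Bool.eq_not_of_ne hj.1.symm]
      · rw [← hxy.2 m hm, hj.2 m hm]
    have hset : ({x, y, p} : Finset V) = {y, p, x} := by ext; simp; tauto
    rw [hset, treeColouring_triple hpy.symm hyp hxy.symm]
    simp [Bool.eq_not_of_ne hxy.1.symm]
  · have hset : ({x, y, p} : Finset V) = {x, p, y} := by ext; simp; tauto
    rw [hset, treeColouring_triple hpx.symm (fun m hm => hj.2 m (hij.trans_le hm)) hxy]
    grind

theorem redLine_comm (f : Finset V → Bool) (u v : V) : redLine f u v = redLine f v u := by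
  ext p
  simp only [redLine, Set.mem_union, Set.mem_insert_iff, Set.mem_singleton_iff,
    Set.mem_ofPred_eq, Finset.insert_comm u v]
  tauto

theorem blueLine_comm (f : Finset V → Bool) (u v : V) : blueLine f u v = blueLine f v u := by
  ext p
  simp only [blueLine, Set.mem_union, Set.mem_insert_iff, Set.mem_singleton_iff,
    Set.mem_ofPred_eq, Finset.insert_comm u v]
  tauto

theorem redLine_treeColouring (hb : ∀ x y : V, x ≠ y → ∃ i, IsTopDiff b x y i)
    {x y : V} {i : ℕ} (hxy : IsTopDiff b x y i) (hx : b x i = true) :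
    redLine (treeColouring b) x y = treeLine b x i := by
  have hx' : x ∈ treeLine b x i := Or.inl rfl
  have hy' : y ∈ treeLine b x i := Or.inr (Or.inl hxy)
  ext p
  have := treeColouring_eq_iff hb hxy (p := p)
  simp only [redLine, Set.mem_union, Set.mem_insert_iff, Set.mem_singleton_iff,
    Set.mem_ofPred_eq]
  grind

theorem blueLine_treeColouring (hb : ∀ x y : V, x ≠ y → ∃ i, IsTopDiff b x y i)
    {x y : V} {i : ℕ} (hxy : IsTopDiff b x y i) (hx : b x i = false) :
    blueLine (treeColouring b) x y = treeLine b x i := by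
  have hx' : x ∈ treeLine b x i := Or.inl rfl
  have hy' : y ∈ treeLine b x i := Or.inr (Or.inl hxy)
  ext p
  have := treeColouring_eq_iff hb hxy (p := p)
  simp only [blueLine, Set.mem_union, Set.mem_insert_iff, Set.mem_singleton_iff,
    Set.mem_ofPred_eq]
  grind

/-- If any two points are separated within the first `k` bits, the tree colouring has at most
`|V| * k` lines. -/
theorem numRed_add_numBlue_treeColouring_le [Fintype V] {k : ℕ}
    (hb : ∀ x y : V, x ≠ y → ∃ i < k, IsTopDiff b x y i) :
    numRed (treeColouring b) + numBlue (treeColouring b) ≤ Fintype.card V * k := by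
  classical
  have hb' : ∀ x y : V, x ≠ y → ∃ i, IsTopDiff b x y i :=
    fun x y h => (hb x y h).imp fun _ => And.right
  let P : Finset (V × ℕ) := Finset.univ ×ˢ Finset.range k
  let line : V × ℕ → Set V := fun q => treeLine b q.1 q.2
  have hred : redLines (treeColouring b) ⊆ ((P.filter fun q => b q.1 q.2 = true).image line) := by
    rintro L ⟨u, v, huv, rfl⟩
    obtain ⟨i, hi, h⟩ := hb u v huv
    simp only [Finset.coe_image, Set.mem_image, Finset.mem_coe, Finset.mem_filter]
    cases hu : b u i
    · have hv : b v i = true := by have := h.1; grind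
      exact ⟨(v, i), ⟨by simp [P, hi], hv⟩, by
        rw [redLine_comm, redLine_treeColouring hb' h.symm hv]⟩
    · exact ⟨(u, i), ⟨by simp [P, hi], hu⟩, (redLine_treeColouring hb' h hu).symm⟩
  have hblue : blueLines (treeColouring b) ⊆
      ((P.filter fun q => ¬ b q.1 q.2 = true).image line) := by
    rintro L ⟨u, v, huv, rfl⟩
    obtain ⟨i, hi, h⟩ := hb u v huv
    simp only [Finset.coe_image, Set.mem_image, Finset.mem_coe, Finset.mem_filter]
    cases hu : b u i
    · exact ⟨(u, i), ⟨by simp [P, hi], by simp [hu]⟩, (blueLine_treeColouring hb' h hu).symm⟩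
    · have hv : b v i = false := by have := h.1; grind
      exact ⟨(v, i), ⟨by simp [P, hi], by simp [hv]⟩, by
        rw [blueLine_comm, blueLine_treeColouring hb' h.symm hv]⟩
  have h1 := (Set.ncard_le_ncard hred).trans (Set.ncard_coe_finset _ |>.le.trans
    Finset.card_image_le)
  have h2 := (Set.ncard_le_ncard hblue).trans (Set.ncard_coe_finset _ |>.le.trans
    Finset.card_image_le)
  have hP : P.card = Fintype.card V * k := by simp [P]
  rw [← hP, ← Finset.card_filter_add_card_filter_not (s := P) fun q => b q.1 q.2 = true]
  exact add_le_add h1 h2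

end Tree

theorem exists_isTopDiff_testBit {n k : ℕ} (hn : n ≤ 2 ^ k) (x y : Fin n) (hxy : x ≠ y) :
    ∃ i < k, IsTopDiff (fun z : Fin n => (z : ℕ).testBit) x y i := by
  have hne : (x : ℕ) ^^^ (y : ℕ) ≠ 0 := by simpa [Fin.val_inj] using hxy
  obtain ⟨i, hi, htop⟩ := Nat.exists_most_significant_bit hne
  have hi' : (x : ℕ).testBit i ≠ (y : ℕ).testBit i := by simpa using hi
  refine ⟨i, ?_, hi', fun j hj => by simpa using htop j hj⟩
  by_contra! hki
  have hlt : ∀ z : Fin n, (z : ℕ).testBit i = false := fun z =>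
    Nat.testBit_lt_two_pow ((z.2.trans_le hn).trans_le (Nat.pow_le_pow_right two_pos hki))
  exact hi' (by rw [hlt, hlt])

/-- For every `n ≥ 2` there is a bi-coloured system on `n` points with
`m_S ≤ n · ⌈log₂ n⌉`. -/
theorem stmt_4 (n : ℕ) (hn : 2 ≤ n) :
    ∃ f : Finset (Fin n) → Bool, numRed f + numBlue f ≤ n * Nat.clog 2 n := by
  refine ⟨treeColouring fun z => (z : ℕ).testBit, ?_⟩
  simpa using numRed_add_numBlue_treeColouring_le
    (exists_isTopDiff_testBit (Nat.le_pow_clog one_lt_two n))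
end

section
/- Let k be a positive integer and let S be a bi-coloured system on n points in which any two distinct red lines intersect in at most k points. Then m_S ≥ C(n,2) / C(k+2,2), i.e., m_S(R) + m_S(B) ≥ (n(n−1)) / ((k+2)(k+1)). -/
theorem Finset.card_le_ncard_of_coe_mem {V : Type*} [Finite V] {T : Finset (Finset V)}
    {A : Set (Set V)}
    (h : ∀ s ∈ T, (s : Set V) ∈ A) : T.card ≤ A.ncard := by
  rw [← Set.ncard_coe_finset, ← Set.ncard_image_of_injective _ Finset.coe_injective]
  exact Set.ncard_le_ncard (by rintro _ ⟨s, hs, rfl⟩; exact h s hs) (Set.toFinite _)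

/-- The line of colour `c` generated by a pair of points, given as a finset `s`. -/
def pairLine {V : Type*} [Fintype V] [DecidableEq V] (f : Finset V → Bool) (c : Bool)
    (s : Finset V) : Finset V :=
  {p | p ∈ s ∨ f (insert p s) = c}

section PairLine

variable {V : Type*} [Fintype V] [DecidableEq V] (f : Finset V → Bool)

theorem mem_pairLine {c : Bool} {s : Finset V} {p : V} :
    p ∈ pairLine f c s ↔ p ∈ s ∨ f (insert p s) = c := by
  simp [pairLine]

theorem subset_pairLine (c : Bool) (s : Finset V) : s ⊆ pairLine f c s :=
  fun _ hp => (mem_pairLine f).2 (Or.inl hp)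

theorem coe_pairLine_pair (c : Bool) (u v : V) :
    (pairLine f c {u, v} : Set V) = {u, v} ∪ {p | p ≠ u ∧ p ≠ v ∧ f {u, v, p} = c} := by
  ext p
  have h : insert p {u, v} = ({u, v, p} : Finset V) := by
    ext x
    simp only [Finset.mem_insert, Finset.mem_singleton]
    tauto
  simp only [Finset.mem_coe, mem_pairLine, h, Finset.mem_insert, Finset.mem_singleton,
    Set.mem_union, Set.mem_insert_iff, Set.mem_singleton_iff, Set.mem_ofPred_eq]
  tauto

theorem coe_pairLine_true_mem_redLines {s : Finset V} (hs : s.card = 2) :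
    (pairLine f true s : Set V) ∈ redLines f := by
  obtain ⟨u, v, huv, rfl⟩ := Finset.card_eq_two.1 hs
  exact ⟨u, v, huv, coe_pairLine_pair f true u v⟩

theorem coe_pairLine_false_mem_blueLines {s : Finset V} (hs : s.card = 2) :
    (pairLine f false s : Set V) ∈ blueLines f := by
  obtain ⟨u, v, huv, rfl⟩ := Finset.card_eq_two.1 hs
  exact ⟨u, v, huv, coe_pairLine_pair f false u v⟩

/-- Away from `s`, the two lines generated by `s` are complementary. -/
theorem mem_sdiff_pairLine_true {s : Finset V} {p : V} :
    p ∈ pairLine f true s \ s ↔ p ∉ pairLine f false s := by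
  simp only [Finset.mem_sdiff, mem_pairLine]
  cases f (insert p s) <;> simp

theorem sdiff_pairLine_true_eq {s t : Finset V}
    (h : pairLine f false s = pairLine f false t) :
    pairLine f true s \ s = pairLine f true t \ t := by
  ext p
  rw [mem_sdiff_pairLine_true, mem_sdiff_pairLine_true, h]

theorem eq_of_pairLine_eq {s t : Finset V} (hred : pairLine f true s = pairLine f true t)
    (hblue : pairLine f false s = pairLine f false t) : s = t := by
  rw [← Finset.sdiff_sdiff_eq_self (subset_pairLine f true s), sdiff_pairLine_true_eq f hblue,
    hred, Finset.sdiff_sdiff_eq_self (subset_pairLine f true t)]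

/-- Two pairs with the same blue line and distinct red lines `L₁`, `L₂` satisfy
`|L₁| ≤ |L₁ ∩ L₂| + 2`. -/
theorem card_pairLine_true_le {s t : Finset V} (hs : s.card = 2)
    (hblue : pairLine f false s = pairLine f false t) :
    (pairLine f true s).card ≤ (pairLine f true s ∩ pairLine f true t).card + 2 := by
  rw [← Finset.card_sdiff_add_card_eq_card (subset_pairLine f true s), hs]
  refine Nat.add_le_add_right (Finset.card_le_card (Finset.subset_inter Finset.sdiff_subset ?_)) 2
  rw [sdiff_pairLine_true_eq f hblue]
  exact Finset.sdiff_subset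

theorem card_pairs_small_red_le (m : ℕ) :
    ((Finset.univ.powersetCard 2).filter fun s => (pairLine f true s).card ≤ m).card ≤
      m.choose 2 * numRed f := by
  refine (Finset.card_le_mul_card_image (f := pairLine f true) _ (m.choose 2) ?_).trans
    (Nat.mul_le_mul_left _ (Finset.card_le_ncard_of_coe_mem ?_))
  · intro L hL
    simp only [Finset.mem_image, Finset.mem_filter] at hL
    obtain ⟨s, ⟨-, hs⟩, rfl⟩ := hL
    refine le_trans ?_ (Nat.choose_le_choose 2 hs)
    rw [← Finset.card_powersetCard]
    refine Finset.card_le_card fun t ht => ?_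
    simp only [Finset.mem_filter, Finset.mem_powersetCard] at ht ⊢
    exact ⟨ht.2 ▸ subset_pairLine f true t, ht.1.1.2⟩
  · intro L hL
    simp only [Finset.mem_image, Finset.mem_filter, Finset.mem_powersetCard] at hL
    obtain ⟨s, ⟨⟨-, hs⟩, -⟩, rfl⟩ := hL
    exact coe_pairLine_true_mem_redLines f hs

theorem card_pairs_large_red_le {k : ℕ}
    (hinter : ∀ L₁ ∈ redLines f, ∀ L₂ ∈ redLines f, L₁ ≠ L₂ → (L₁ ∩ L₂).ncard ≤ k) :
    ((Finset.univ.powersetCard 2).filter fun s => ¬ (pairLine f true s).card ≤ k + 2).card ≤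
      numBlue f := by
  rw [← Finset.card_image_of_injOn (f := pairLine f false)]
  · refine Finset.card_le_ncard_of_coe_mem fun L hL => ?_
    simp only [Finset.mem_image, Finset.mem_filter, Finset.mem_powersetCard] at hL
    obtain ⟨s, ⟨⟨-, hs⟩, -⟩, rfl⟩ := hL
    exact coe_pairLine_false_mem_blueLines f hs
  · intro s hs t ht hblue
    simp only [Finset.coe_filter, Finset.mem_powersetCard, Set.mem_ofPred_eq] at hs ht
    obtain ⟨⟨-, hs⟩, hlarge⟩ := hs
    refine eq_of_pairLine_eq f (by_contra fun hne => hlarge ?_) hblue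
    have h := hinter _ (coe_pairLine_true_mem_redLines f hs) _
      (coe_pairLine_true_mem_redLines f ht.1.2) (mt Finset.coe_inj.1 hne)
    rw [← Finset.coe_inter, Set.ncard_coe_finset] at h
    exact (card_pairLine_true_le f hs hblue).trans (Nat.add_le_add_right h 2)

end PairLine

/-- If any two distinct red lines of a bi-coloured system on `n` points intersect
in at most `k` points (`k ≥ 1`), then `m_S ≥ C(n,2) / C(k+2,2)`. -/
theorem stmt_6 {V : Type*} [Fintype V] [DecidableEq V] (f : Finset V → Bool)
    (k : ℕ) (hk : 1 ≤ k)
    (hinter : ∀ L₁ ∈ redLines f, ∀ L₂ ∈ redLines f, L₁ ≠ L₂ → (L₁ ∩ L₂).ncard ≤ k) :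
    ((Nat.choose (Fintype.card V) 2 : ℝ) / (Nat.choose (k + 2) 2 : ℝ)) ≤
      (numRed f + numBlue f : ℝ) := by
  have hpos : 0 < (k + 2).choose 2 := Nat.choose_pos (by omega)
  rw [div_le_iff₀ (by exact_mod_cast hpos)]
  have hsplit := Finset.card_filter_add_card_filter_not
    (s := (Finset.univ : Finset V).powersetCard 2) fun s => (pairLine f true s).card ≤ k + 2
  rw [Finset.card_powersetCard, Finset.card_univ] at hsplit
  have hred := card_pairs_small_red_le f (k + 2)
  have hblue := (card_pairs_large_red_le f hinter).trans (Nat.le_mul_of_pos_right _ hpos)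
  have h : (Fintype.card V).choose 2 ≤ (numRed f + numBlue f) * (k + 2).choose 2 := by
    rw [← hsplit, add_mul, mul_comm (numRed f)]
    exact add_le_add hred hblue
  exact_mod_cast h
end

section
/- Let k be a positive integer and let S = (V, f) be a bi-coloured system in which any two distinct red lines intersect in at most k points. If {a, b} and {c, d} are two distinct 2-element subsets of V with |R(ab)| > k + 2 and |R(cd)| > k + 2, then the blue lines B(ab) and B(cd) are distinct sets. -/
/-- The points off the blue line are those of the red line other than its generators. -/
theorem compl_blueLine {V : Type*} [DecidableEq V] (f : Finset V → Bool) (u v : V) :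
    (blueLine f u v)ᶜ = redLine f u v \ {u, v} := by
  ext p
  simp only [redLine, blueLine, Set.mem_compl_iff, Set.mem_sdiff, Set.mem_union,
    Set.mem_insert_iff, Set.mem_singleton_iff, Set.mem_ofPred_eq]
  grind

/-- In a bi-coloured system where any two distinct red lines intersect in at most
`k` points, if `{a,b}` and `{c,d}` are two distinct pairs whose red lines both
have more than `k + 2` points, then the blue lines `B(ab)` and `B(cd)` are
distinct sets. -/
theorem stmt_7 {V : Type*} [Fintype V] [DecidableEq V] (f : Finset V → Bool)
    (k : ℕ) (hk : 1 ≤ k)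
    (hinter : ∀ L₁ ∈ redLines f, ∀ L₂ ∈ redLines f, L₁ ≠ L₂ → (L₁ ∩ L₂).ncard ≤ k)
    (a b c d : V) (hab : a ≠ b) (hcd : c ≠ d)
    (hpairs : ({a, b} : Finset V) ≠ {c, d})
    (hRab : k + 2 < (redLine f a b).ncard)
    (hRcd : k + 2 < (redLine f c d).ncard) :
    blueLine f a b ≠ blueLine f c d := by
  intro hB
  have hcompl : (blueLine f a b)ᶜ ⊆ redLine f a b ∩ redLine f c d := by
    apply Set.subset_inter
    · rw [compl_blueLine]
      exact Set.sdiff_subset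
    · rw [hB, compl_blueLine]
      exact Set.sdiff_subset
  have hcard : k < (redLine f a b ∩ redLine f c d).ncard := by
    have hle := Set.ncard_le_ncard hcompl
    rw [compl_blueLine] at hle
    have hdiff := Set.le_ncard_sdiff {a, b} (redLine f a b)
    rw [Set.ncard_pair hab] at hdiff
    omega
  have hR : redLine f a b = redLine f c d := by
    by_contra hne
    exact absurd (hinter _ ⟨a, b, hab, rfl⟩ _ ⟨c, d, hcd, rfl⟩ hne) hcard.not_ge
  apply hpairs
  apply Finset.coe_injective
  rw [Finset.coe_pair, Finset.coe_pair, ← redLine_inter_blueLine f a b,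
    ← redLine_inter_blueLine f c d, hR, hB]
end

section
/- Let S be the bi-coloured system derived from a finite tree T. Let x be a vertex of T having at least one twin, let C be the set consisting of x together with all twins of x, and let y be a vertex with y ∉ C that is not adjacent to x. Then R(xy) ∩ C = {x} and C ⊆ B(xy). -/
/-- Three vertices `x, y, z` of a graph are collinear if one of them lies on a
shortest path (in a tree: the unique path) between the other two, i.e.
`d(x,y) + d(y,z) = d(x,z)` for some ordering of the triple. -/
def Collin {V : Type*} (G : SimpleGraph V) (x y z : V) : Prop :=
  G.dist x y + G.dist y z = G.dist x z ∨
  G.dist y x + G.dist x z = G.dist y z ∨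
  G.dist x z + G.dist z y = G.dist x y

/-- The red line generated by two distinct vertices `u`, `v` in the bi-coloured
system derived from the graph `G`: a triple is red iff it is collinear. -/
def treeRedLine {V : Type*} (G : SimpleGraph V) (u v : V) : Set V :=
  {u, v} ∪ {p | p ≠ u ∧ p ≠ v ∧ Collin G u v p}

/-- The blue line generated by two distinct vertices `u`, `v` in the bi-coloured
system derived from the graph `G`: a triple is blue iff it is not collinear. -/
def treeBlueLine {V : Type*} (G : SimpleGraph V) (u v : V) : Set V :=
  {u, v} ∪ {p | p ≠ u ∧ p ≠ v ∧ ¬ Collin G u v p}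

/-- The set of distinct red lines of the system derived from `G`. -/
def treeRedLines {V : Type*} (G : SimpleGraph V) : Set (Set V) :=
  {L | ∃ u v : V, u ≠ v ∧ L = treeRedLine G u v}

/-- The set of distinct blue lines of the system derived from `G`. -/
def treeBlueLines {V : Type*} (G : SimpleGraph V) : Set (Set V) :=
  {L | ∃ u v : V, u ≠ v ∧ L = treeBlueLine G u v}

/-- `m_S(R)`, the number of distinct red lines of the system derived from `G`. -/
noncomputable def treeNumRed {V : Type*} (G : SimpleGraph V) : ℕ :=
  (treeRedLines G).ncard

/-- `m_S(B)`, the number of distinct blue lines of the system derived from `G`. -/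
noncomputable def treeNumBlue {V : Type*} (G : SimpleGraph V) : ℕ :=
  (treeBlueLines G).ncard

/-- Two vertices are twins if they are distinct, non-adjacent and have identical
neighbourhoods. -/
def Twins {V : Type*} (G : SimpleGraph V) (x y : V) : Prop :=
  x ≠ y ∧ ¬ G.Adj x y ∧ G.neighborSet x = G.neighborSet y

open SimpleGraph

theorem Twins.symm {V : Type*} {G : SimpleGraph V} {x z : V} (h : Twins G x z) :
    Twins G z x :=
  ⟨h.1.symm, fun hzx => h.2.1 hzx.symm, h.2.2.symm⟩

theorem Twins.adj_iff {V : Type*} {G : SimpleGraph V} {x z : V} (h : Twins G x z) (w : V) :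
    G.Adj x w ↔ G.Adj z w := by
  rw [← mem_neighborSet, ← mem_neighborSet, h.2.2]

theorem Twins.dist_le {V : Type*} {G : SimpleGraph V} (hG : G.Connected) {x z y : V}
    (h : Twins G x z) (hxy : x ≠ y) : G.dist z y ≤ G.dist x y := by
  obtain ⟨p, hp⟩ := hG.exists_walk_length_eq_dist x y
  rw [← hp]
  cases p with
  | nil => exact absurd rfl hxy
  | cons hadj q => exact SimpleGraph.dist_le (Walk.cons ((h.adj_iff _).1 hadj) q)

theorem Twins.dist_eq {V : Type*} {G : SimpleGraph V} (hG : G.Connected) {x z y : V}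
    (h : Twins G x z) (hxy : x ≠ y) (hzy : z ≠ y) : G.dist x y = G.dist z y :=
  le_antisymm (h.symm.dist_le hG hzy) (h.dist_le hG hxy)

theorem Twins.dist_le_two {V : Type*} {G : SimpleGraph V} (hG : G.Connected) {x z : V}
    (h : Twins G x z) : G.dist x z ≤ 2 := by
  obtain ⟨p⟩ := hG.preconnected x z
  cases p with
  | nil => exact absurd rfl h.1
  | cons hadj _ =>
    exact SimpleGraph.dist_le (Walk.cons hadj (Walk.cons ((h.adj_iff _).1 hadj).symm Walk.nil))

theorem Twins.not_collin {V : Type*} {G : SimpleGraph V} (hG : G.Connected) {x z y : V}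
    (h : Twins G x z) (hxy : x ≠ y) (hzy : z ≠ y) (hadj : ¬ G.Adj x y) :
    ¬ Collin G x y z := by
  have hd := h.dist_eq hG hxy hzy
  have hle := h.dist_le_two hG
  have hpos := hG.pos_dist_of_ne h.1
  have hxy_pos := hG.pos_dist_of_ne hxy
  have hne : G.dist x y ≠ 1 := fun h1 => hadj (dist_eq_one_iff_adj.1 h1)
  unfold Collin
  rw [G.dist_comm (u := y) (v := x), G.dist_comm (u := y) (v := z)]
  omega

/-- In the system derived from a tree, let `x` have at least one twin, let `C`
consist of `x` together with all twins of `x`, and let `y ∉ C` be non-adjacent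
to `x`. Then `R(xy) ∩ C = {x}` and `C ⊆ B(xy)`. -/
theorem stmt_9 {V : Type*} [Fintype V] (G : SimpleGraph V) (hG : G.IsTree)
    (x y : V) (htwin : ∃ z, Twins G x z)
    (C : Set V) (hC : C = {x} ∪ {z | Twins G x z})
    (hyC : y ∉ C) (hadj : ¬ G.Adj x y) :
    treeRedLine G x y ∩ C = {x} ∧ C ⊆ treeBlueLine G x y := by
  subst hC
  have hyx : x ≠ y := fun h => hyC (Or.inl h.symm)
  have key : ∀ z, Twins G x z → z ≠ y ∧ ¬ Collin G x y z := fun z hz =>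
    have hzy : z ≠ y := fun h => hyC (Or.inr (h ▸ hz))
    ⟨hzy, hz.not_collin hG.connected hyx hzy hadj⟩
  refine ⟨Set.Subset.antisymm ?_ ?_, ?_⟩
  · rintro z ⟨hz, rfl | htw⟩
    · rfl
    · rcases hz with (rfl | rfl) | ⟨-, -, hcol⟩
      · rfl
      · exact absurd rfl (key _ htw).1
      · exact absurd hcol (key z htw).2
  · rintro z rfl
    exact ⟨Or.inl (Or.inl rfl), Or.inl rfl⟩
  · rintro z (rfl | htw)
    · exact Or.inl (Or.inl rfl)
    · exact Or.inr ⟨htw.1.symm, key z htw⟩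
end

section
/- Let S be the bi-coloured system derived from a finite tree T. Let C be a twin class of T (a maximal set of at least two vertices that are pairwise twins), and let x and y be two distinct vertices neither of which belongs to C. Then R(xy) ∩ C is either ∅ or C, and likewise B(xy) ∩ C is either ∅ or C. -/
/-- A twin class of a graph: a maximal set of at least two pairwise twin
vertices, i.e. the set consisting of a vertex `v` having a twin together with
all twins of `v`. -/
def IsTwinClass {V : Type*} (G : SimpleGraph V) (C : Set V) : Prop :=
  ∃ v w : V, Twins G v w ∧ C = {u | u = v ∨ Twins G v u}

/-- In a connected graph, vertices with the same neighbourhood are equidistant from every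
other vertex. -/
theorem dist_eq_of_neighborSet_eq {V : Type*} {G : SimpleGraph V} (hG : G.Connected) {u v x : V}
    (h : G.neighborSet u = G.neighborSet v) (hu : x ≠ u) (hv : x ≠ v) :
    G.dist x u = G.dist x v := by
  have key : ∀ {a b : V}, G.neighborSet a = G.neighborSet b → x ≠ a →
      G.dist x b ≤ G.dist x a := by
    intro a b hab hxa
    obtain ⟨p, hp⟩ := hG.exists_walk_length_eq_dist a x
    cases p with
    | nil => exact absurd rfl hxa
    | @cons _ c _ hac q =>
      have hbc : G.Adj b c := by
        rw [← SimpleGraph.mem_neighborSet, ← hab]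
        exact hac
      rw [SimpleGraph.dist_comm, G.dist_comm (u := x), ← hp]
      exact SimpleGraph.dist_le (SimpleGraph.Walk.cons hbc q)
  exact le_antisymm (key h.symm hv) (key h hu)

/-- In the system derived from a tree, if `C` is a twin class and `x ≠ y` are
two vertices neither of which belongs to `C`, then `R(xy) ∩ C` is `∅` or `C`,
and likewise `B(xy) ∩ C` is `∅` or `C`. -/
theorem stmt_10 {V : Type*} [Fintype V] (G : SimpleGraph V) (hG : G.IsTree)
    (C : Set V) (hC : IsTwinClass G C)
    (x y : V) (hxy : x ≠ y) (hx : x ∉ C) (hy : y ∉ C) :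
    (treeRedLine G x y ∩ C = ∅ ∨ treeRedLine G x y ∩ C = C) ∧
    (treeBlueLine G x y ∩ C = ∅ ∨ treeBlueLine G x y ∩ C = C) := by
  obtain ⟨v, w, -, rfl⟩ := hC
  have hdist : ∀ z, z ∉ {u | u = v ∨ Twins G v u} → ∀ p ∈ {u | u = v ∨ Twins G v u},
      G.dist z p = G.dist z v := by
    rintro z hz p (rfl | hp)
    · rfl
    · exact dist_eq_of_neighborSet_eq hG.connected hp.2.2.symm
        (fun h => hz (Or.inr (h ▸ hp))) (fun h => hz (Or.inl h))
  have hcollin : ∀ p ∈ {u | u = v ∨ Twins G v u}, (Collin G x y p ↔ Collin G x y v) := by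
    intro p hp
    simp only [Collin, G.dist_comm (u := p), G.dist_comm (u := v), hdist x hx p hp,
      hdist y hy p hp]
  generalize {u | u = v ∨ Twins G v u} = C at *
  have hne : ∀ p ∈ C, p ≠ x ∧ p ≠ y := fun p hp =>
    ⟨fun h => hx (h ▸ hp), fun h => hy (h ▸ hp)⟩
  have hred : ∀ p ∈ C, (p ∈ treeRedLine G x y ↔ Collin G x y v) := by
    intro p hp
    simp [treeRedLine, hne p hp, hcollin p hp]
  have hblue : ∀ p ∈ C, (p ∈ treeBlueLine G x y ↔ ¬ Collin G x y v) := by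
    intro p hp
    simp [treeBlueLine, hne p hp, hcollin p hp]
  simp only [Set.inter_eq_right, ← Set.disjoint_iff_inter_eq_empty, Set.disjoint_right]
  by_cases h : Collin G x y v
  · exact ⟨Or.inr fun p hp => (hred p hp).2 h, Or.inl fun p hp hb => (hblue p hp).1 hb h⟩
  · exact ⟨Or.inl fun p hp hr => h ((hred p hp).1 hr), Or.inr fun p hp => (hblue p hp).2 h⟩
end

section
/- Let S be the bi-coloured system derived from a finite tree T, and let x, y, z, w be four distinct vertices of T such that B(xy) = B(zw). Then either (x, z) and (y, w) are two pairs of twins, or (x, w) and (y, z) are two pairs of twins. -/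
namespace SimpleGraph

variable {V : Type*} {G : SimpleGraph V}

lemma Connected.exists_adj_dist_add_one_eq (hG : G.Connected) {u v : V} (h : u ≠ v) :
    ∃ w, G.Adj u w ∧ G.dist w v + 1 = G.dist u v := by
  obtain ⟨p, hp⟩ := hG.exists_walk_length_eq_dist u v
  cases p with
  | nil => exact absurd rfl h
  | @cons _ w _ hadj q =>
    refine ⟨w, hadj, ?_⟩
    have hq := G.dist_le q
    have htri := hG.dist_triangle (u := u) (v := w) (w := v)
    rw [dist_eq_one_iff_adj.2 hadj] at htri
    rw [Walk.length_cons] at hp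
    omega

/-- In a tree, each vertex has at most one neighbour closer to a given vertex. -/
lemma IsTree.eq_of_adj_of_dist_add_one_eq (hG : G.IsTree) {u v a b : V}
    (hav : G.Adj a v) (hbv : G.Adj b v) (ha : G.dist u a + 1 = G.dist u v)
    (hb : G.dist u b + 1 = G.dist u v) : a = b := by
  obtain ⟨p, hp⟩ := hG.connected.exists_walk_length_eq_dist u a
  obtain ⟨q, hq⟩ := hG.connected.exists_walk_length_eq_dist u b
  have hp' : (p.concat hav).IsPath := Walk.isPath_of_length_eq_dist _ (by simp [hp, ha])
  have hq' : (q.concat hbv).IsPath := Walk.isPath_of_length_eq_dist _ (by simp [hq, hb])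
  have h := congrArg Subtype.val
    ((hG.isAcyclic.subsingleton_path u v).elim ⟨_, hp'⟩ ⟨_, hq'⟩)
  simpa using congrArg Walk.penultimate h

/-- In a tree, a path joining the two sides of an edge passes through that edge. -/
lemma IsTree.dist_eq_add_of_adj (hG : G.IsTree) {u v y z : V} (huv : G.Adj u v)
    (hy : G.dist u y = G.dist v y + 1) (hz : G.dist v z = G.dist u z + 1) :
    G.dist z y = G.dist z u + G.dist u y := by
  induction hn : G.dist z u generalizing z with
  | zero => simp [hG.connected.dist_eq_zero_iff.1 hn]
  | succ n ih =>
    have hconn := hG.connected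
    obtain ⟨z', hzz', hz'⟩ := hconn.exists_adj_dist_add_one_eq (u := z) (v := u)
      (by rintro rfl; simp at hn)
    have h1 := dist_eq_one_iff_adj.2 hzz'
    have h2 := dist_eq_one_iff_adj.2 huv
    have hvz' : G.dist v z' = G.dist u z' + 1 := by
      have := hconn.dist_triangle (u := v) (v := z') (w := z)
      have := hconn.dist_triangle (u := v) (v := u) (w := z')
      grind [dist_comm]
    have hz'y := ih hvz' (by omega)
    obtain ⟨t, hzt, ht⟩ := hconn.exists_adj_dist_add_one_eq (u := z') (v := v)
      (by rintro rfl; simp at hvz')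
    have hty := hconn.dist_triangle (u := t) (v := v) (w := y)
    have hz't := hconn.dist_triangle (u := z') (v := t) (w := y)
    have h3 := dist_eq_one_iff_adj.2 hzt
    have hcases := hG.dist_eq_dist_add_one_of_adj y hzz'
    by_contra hne
    have htz : t = z := hG.eq_of_adj_of_dist_add_one_eq (u := y) hzt.symm hzz'
      (by grind [dist_comm]) (by grind [dist_comm])
    subst htz
    grind [dist_comm]

/-- The four-point condition for the distance of a tree. -/
lemma IsTree.dist_add_dist_le_max (hG : G.IsTree) (x y z w : V) :
    G.dist x y + G.dist z w ≤
      max (G.dist x z + G.dist y w) (G.dist x w + G.dist y z) := by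
  induction hn : G.dist x y generalizing x with
  | zero =>
    rw [hG.connected.dist_eq_zero_iff] at hn
    subst hn
    have := hG.connected.dist_triangle (u := z) (v := x) (w := w)
    grind [dist_comm]
  | succ n ih =>
    have hconn := hG.connected
    obtain ⟨v, hxv, hv⟩ := hconn.exists_adj_dist_add_one_eq (u := x) (v := y)
      (by rintro rfl; simp at hn)
    have hih := ih v (by omega)
    have htri := hconn.dist_triangle (u := z) (v := x) (w := w)
    rcases hG.dist_eq_dist_add_one_of_adj z hxv with hz | hz
    · rcases hG.dist_eq_dist_add_one_of_adj w hxv with hw | hw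
      · grind [dist_comm]
      · have := hG.dist_eq_add_of_adj (z := w) hxv hv.symm (by grind [dist_comm])
        grind [dist_comm]
    · have := hG.dist_eq_add_of_adj (z := z) hxv hv.symm (by grind [dist_comm])
      grind [dist_comm]

lemma Connected.dist_eq_add_one_of_forall_adj_iff (hG : G.Connected) {x c p : V}
    (hc : ∀ q, G.Adj x q ↔ q = c) (hp : x ≠ p) : G.dist x p = G.dist c p + 1 := by
  obtain ⟨q, hxq, hq⟩ := hG.exists_adj_dist_add_one_eq hp
  rw [← (hc q).1 hxq, hq]

end SimpleGraph

section BlueLine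

variable {V : Type*} {G : SimpleGraph V}

lemma mem_treeBlueLine {u v p : V} :
    p ∈ treeBlueLine G u v ↔ p = u ∨ p = v ∨ p ≠ u ∧ p ≠ v ∧ ¬ Collin G u v p := by
  simp [treeBlueLine, or_assoc]

lemma treeBlueLine_comm (u v : V) : treeBlueLine G u v = treeBlueLine G v u := by
  ext p
  simp only [mem_treeBlueLine, Collin]
  grind [SimpleGraph.dist_comm]

/-- If four distinct vertices of a tree satisfy `B(xy) = B(zw)`, every neighbour of `z` lies
strictly between `x` and `y`, and is nearer to both than `z`. -/
lemma between_of_adj_of_treeBlueLine_eq (hG : G.IsTree) {x y z w q : V}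
    (hxz : x ≠ z) (hxw : x ≠ w) (hyz : y ≠ z) (hzw : z ≠ w)
    (heq : treeBlueLine G x y = treeBlueLine G z w) (hzq : G.Adj z q) :
    q ≠ x ∧ q ≠ y ∧ G.dist x q + G.dist q y = G.dist x y ∧
      G.dist z x = G.dist q x + 1 ∧ G.dist z y = G.dist q y + 1 := by
  have hconn := hG.connected
  have h1 := SimpleGraph.dist_eq_one_iff_adj.2 hzq
  have hz : ¬ Collin G x y z := by
    have : z ∈ treeBlueLine G x y := heq ▸ mem_treeBlueLine.2 (Or.inl rfl)
    grind [mem_treeBlueLine]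
  have hx : ¬ Collin G z w x := by
    have : x ∈ treeBlueLine G z w := heq ▸ mem_treeBlueLine.2 (Or.inl rfl)
    grind [mem_treeBlueLine]
  have hqw : q ≠ w := by
    rintro rfl
    have := hG.dist_eq_dist_add_one_of_adj x hzq
    unfold Collin at hx
    grind [SimpleGraph.dist_comm]
  have hq : q ∉ treeBlueLine G x y := by
    rw [heq, mem_treeBlueLine]
    have := hG.dist_eq_dist_add_one_of_adj w hzq
    have := hzq.ne
    unfold Collin
    grind [SimpleGraph.dist_comm]
  have hqx : q ≠ x := by grind [mem_treeBlueLine]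
  have hqy : q ≠ y := by grind [mem_treeBlueLine]
  have hcol : Collin G x y q := by grind [mem_treeBlueLine]
  have px := hconn.pos_dist_of_ne hqx
  have py := hconn.pos_dist_of_ne hqy
  have cx := hG.dist_eq_dist_add_one_of_adj x hzq
  have cy := hG.dist_eq_dist_add_one_of_adj y hzq
  have t1 := hconn.dist_triangle (u := z) (v := x) (w := y)
  have t2 := hconn.dist_triangle (u := z) (v := y) (w := x)
  have t3 := hconn.dist_triangle (u := x) (v := z) (w := y)
  have f1 := hG.dist_add_dist_le_max q y z x
  have f2 := hG.dist_add_dist_le_max q x z y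
  unfold Collin at hz hcol
  simp only [G.dist_comm (u := x) (v := z), G.dist_comm (u := y) (v := z),
    G.dist_comm (u := y) (v := x), G.dist_comm (u := x) (v := q),
    G.dist_comm (u := y) (v := q), G.dist_comm (u := q) (v := z)] at *
  refine ⟨hqx, hqy, ?_⟩
  omega

lemma exists_forall_adj_iff_of_treeBlueLine_eq (hG : G.IsTree) {x y z w : V}
    (hxz : x ≠ z) (hxw : x ≠ w) (hyz : y ≠ z) (hzw : z ≠ w)
    (heq : treeBlueLine G x y = treeBlueLine G z w) :
    ∃ a, (∀ q, G.Adj z q ↔ q = a) ∧ a ≠ x ∧ a ≠ y ∧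
      G.dist x a + G.dist a y = G.dist x y := by
  obtain ⟨a, hza, -⟩ := hG.connected.exists_adj_dist_add_one_eq hzw
  have ha := between_of_adj_of_treeBlueLine_eq hG hxz hxw hyz hzw heq hza
  refine ⟨a, fun q ↦ ⟨fun hzq ↦ ?_, fun h ↦ h ▸ hza⟩, ha.1, ha.2.1, ha.2.2.1⟩
  have hq := between_of_adj_of_treeBlueLine_eq hG hxz hxw hyz hzw heq hzq
  rw [← hG.connected.dist_eq_zero_iff]
  have f := hG.dist_add_dist_le_max x y q a
  grind [SimpleGraph.dist_comm]

lemma twins_of_forall_adj_iff {x z a : V} (hxz : x ≠ z)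
    (hx : ∀ q, G.Adj x q ↔ q = a) (hz : ∀ q, G.Adj z q ↔ q = a) : Twins G x z := by
  refine ⟨hxz, fun h ↦ ?_, Set.ext fun q ↦ (hx q).trans (hz q).symm⟩
  exact hxz (((hz x).1 h.symm).trans ((hx z).1 h).symm)

end BlueLine

/-- In the system derived from a tree, if `x, y, z, w` are four distinct
vertices with `B(xy) = B(zw)`, then either `(x,z)` and `(y,w)` are two pairs of
twins, or `(x,w)` and `(y,z)` are two pairs of twins. -/
theorem stmt_11 {V : Type*} [Fintype V] (G : SimpleGraph V) (hG : G.IsTree)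
    (x y z w : V)
    (hxy : x ≠ y) (hxz : x ≠ z) (hxw : x ≠ w)
    (hyz : y ≠ z) (hyw : y ≠ w) (hzw : z ≠ w)
    (heq : treeBlueLine G x y = treeBlueLine G z w) :
    (Twins G x z ∧ Twins G y w) ∨ (Twins G x w ∧ Twins G y z) := by
  obtain ⟨a, ha, hax, hay, hab⟩ :=
    exists_forall_adj_iff_of_treeBlueLine_eq hG hxz hxw hyz hzw heq
  obtain ⟨b, hb, hbx, hby, hbb⟩ :=
    exists_forall_adj_iff_of_treeBlueLine_eq hG hxw hxz hyw hzw.symm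
      (heq.trans (treeBlueLine_comm z w))
  obtain ⟨c, hc, hcz, hcw, hcb⟩ :=
    exists_forall_adj_iff_of_treeBlueLine_eq hG hxz.symm hyz.symm hxw.symm hxy heq.symm
  obtain ⟨e, he, hez, hew, heb⟩ :=
    exists_forall_adj_iff_of_treeBlueLine_eq hG hyz.symm hxz.symm hyw.symm hxy.symm
      (heq.symm.trans (treeBlueLine_comm x y))
  have hconn := hG.connected
  have lx := fun p ↦ hconn.dist_eq_add_one_of_forall_adj_iff (p := p) hc
  have ly := fun p ↦ hconn.dist_eq_add_one_of_forall_adj_iff (p := p) he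
  have lz := fun p ↦ hconn.dist_eq_add_one_of_forall_adj_iff (p := p) ha
  have lw := fun p ↦ hconn.dist_eq_add_one_of_forall_adj_iff (p := p) hb
  have hyc : y ≠ c := fun h ↦ hyz (by grind [SimpleGraph.Adj.symm])
  have hwa : w ≠ a := fun h ↦ hxw (by grind [SimpleGraph.Adj.symm])
  have h1 := lx a hax.symm
  have h2 := lx b hbx.symm
  have h3 := lx y hxy
  have h4 := ly a hay.symm
  have h5 := ly b hby.symm
  have h6 := ly c hyc
  have h7 := lz c hcz.symm
  have h8 := lz e hez.symm
  have h9 := lz w hzw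
  have h10 := lw c hcw.symm
  have h11 := lw e hew.symm
  have h12 := lw a hwa
  have f := hG.dist_add_dist_le_max c e a b
  simp only [G.dist_comm (u := a) (v := y), G.dist_comm (u := b) (v := y),
    G.dist_comm (u := c) (v := w), G.dist_comm (u := e) (v := w),
    G.dist_comm (u := c) (v := y), G.dist_comm (u := a) (v := w),
    G.dist_comm (u := a) (v := c), G.dist_comm (u := b) (v := c),
    G.dist_comm (u := a) (v := e), G.dist_comm (u := b) (v := e),
    G.dist_comm (u := e) (v := c), G.dist_comm (u := b) (v := a)] at *
  have key : (G.dist c a = 0 ∧ G.dist e b = 0) ∨ (G.dist c b = 0 ∧ G.dist e a = 0) := by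
    omega
  simp only [hconn.dist_eq_zero_iff] at key
  rcases key with ⟨rfl, rfl⟩ | ⟨rfl, rfl⟩
  · exact Or.inl ⟨twins_of_forall_adj_iff hxz hc ha, twins_of_forall_adj_iff hyw he hb⟩
  · exact Or.inr ⟨twins_of_forall_adj_iff hxw hc hb, twins_of_forall_adj_iff hyz he ha⟩
end
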